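/- arXiv:1708.05041 — 2 statements merged into one kernel-verified Lean document; each statement's English description precedes it below -/
import Mathlib

section
/- If G is a connected, claw-free, cubic graph of order n that is not isomorphic to K_4, then F(G) = n/2 if and only if G is isomorphic to the diamond-necklace N_2 or G is isomorphic to the prism C_3 □ K_2. -/
/-- A set `T` of (colored) vertices is closed under the forcing rule: whenever a colored
vertex `v ∈ T` has the property that all of its neighbors outside `T` are equal to `w`
(i.e. `w` is its unique non-colored neighbor, if `w ∉ T`), then `w ∈ T`. -/
def ForcingClosed {V : Type*} (G : SimpleGraph V) (T : Set V) : Prop :=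
  ∀ v ∈ T, ∀ w, G.Adj v w → (∀ u, G.Adj v u → u ∉ T → u = w) → w ∈ T

/-- `S` is a (zero) forcing set of `G`: iterating the forcing process starting from `S`
colors all vertices; equivalently, every forcing-closed superset of `S` is everything. -/
def IsForcingSet {V : Type*} (G : SimpleGraph V) (S : Set V) : Prop :=
  ∀ T : Set V, S ⊆ T → ForcingClosed G T → ∀ v, v ∈ T

/-- `S` is a total forcing set of `G`: a forcing set whose induced subgraph has no
isolated vertex. -/
def IsTotalForcingSet {V : Type*} (G : SimpleGraph V) (S : Set V) : Prop :=
  IsForcingSet G S ∧ ∀ v ∈ S, ∃ w ∈ S, G.Adj v w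

/-- The forcing number `F(G)`: minimum cardinality of a forcing set. -/
noncomputable def forcingNumber {V : Type*} (G : SimpleGraph V) : ℕ :=
  sInf {n : ℕ | ∃ S : Set V, IsForcingSet G S ∧ S.ncard = n}

/-- The total forcing number `F_t(G)`: minimum cardinality of a total forcing set. -/
noncomputable def totalForcingNumber {V : Type*} (G : SimpleGraph V) : ℕ :=
  sInf {n : ℕ | ∃ S : Set V, IsTotalForcingSet G S ∧ S.ncard = n}

/-- `G` is cubic (3-regular): every vertex has exactly 3 neighbors. -/
def IsCubic {V : Type*} (G : SimpleGraph V) : Prop := ∀ v, (G.neighborSet v).ncard = 3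

/-- `G` is claw-free: it has no induced `K_{1,3}`. -/
def ClawFree {V : Type*} (G : SimpleGraph V) : Prop :=
  ¬ ∃ v a b c : V, G.Adj v a ∧ G.Adj v b ∧ G.Adj v c ∧
    a ≠ b ∧ a ≠ c ∧ b ≠ c ∧ ¬ G.Adj a b ∧ ¬ G.Adj a c ∧ ¬ G.Adj b c

/-- The prism `C₃ □ K₂`, the Cartesian (box) product of a 3-cycle with `K₂`. -/
def prism : SimpleGraph (Fin 3 × Fin 2) :=
  (SimpleGraph.cycleGraph 3).boxProd (⊤ : SimpleGraph (Fin 2))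

/-- The diamond-necklace `N_k`.  Its vertices are pairs `(i, j)` with `i : Fin k`
indexing the diamond and `j : Fin 4` the position inside diamond `D_i`, where
`j = 0, 1, 2, 3` correspond to the vertices `a_i, b_i, c_i, d_i` respectively and
`a_i b_i` is the missing edge of the diamond.  Two vertices in the same diamond are
adjacent unless they are `a_i` and `b_i`, and in addition `a_i` is joined to `b_{i+1}`
(indices modulo `k`). -/
def diamondNecklace (k : ℕ) : SimpleGraph (Fin k × Fin 4) :=
  SimpleGraph.fromRel (fun p q =>
    (p.1 = q.1 ∧ ¬ ((p.2 = 0 ∧ q.2 = 1) ∨ (p.2 = 1 ∧ q.2 = 0))) ∨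
    ((q.1 : ℕ) = ((p.1 : ℕ) + 1) % k ∧ p.2 = 0 ∧ q.2 = 1))


namespace ForcingAux

variable {V : Type*} {G : SimpleGraph V}

/-- The forcing closure of a set. -/
def cl (G : SimpleGraph V) (S : Set V) : Set V :=
  {v | ∀ T : Set V, S ⊆ T → ForcingClosed G T → v ∈ T}

lemma subset_cl (S : Set V) : S ⊆ cl G S := fun _ hv _ hT _ => hT hv

lemma cl_mono {S S' : Set V} (h : S ⊆ S') : cl G S ⊆ cl G S' :=
  fun _ hv T hT hc => hv T (h.trans hT) hc

lemma cl_closed (S : Set V) : ForcingClosed G (cl G S) := by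
  intro v hv w hw hu T hT hc
  refine hc v (hv T hT hc) w hw ?_
  intro u hvu huT
  exact hu u hvu fun h => huT (h T hT hc)

/-- No isolated vertex in the closure. -/
def NoIso (G : SimpleGraph V) (S : Set V) : Prop :=
  ∀ v ∈ cl G S, ∃ w ∈ cl G S, G.Adj v w

lemma noIso_of {S : Set V} (h : ∀ v ∈ S, ∃ w ∈ cl G S, G.Adj v w) : NoIso G S := by
  intro v hv
  have := hv {v | v ∈ cl G S ∧ ∃ w ∈ cl G S, G.Adj v w}
    (fun v hv => ⟨subset_cl S hv, h v hv⟩) ?_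
  · exact this.2
  · rintro v ⟨hv, -⟩ w hw hu
    have : w ∈ cl G S := cl_closed S v hv w hw
      fun u hvu huT => hu u hvu fun h => huT h.1
    exact ⟨this, v, hv, hw.symm⟩

lemma noIso_insert {S : Set V} {v x : V} (h : NoIso G S) (hv : v ∈ cl G S) (hx : G.Adj v x) :
    NoIso G (insert x S) := by
  apply noIso_of
  have hm : cl G S ⊆ cl G (insert x S) := cl_mono (Set.subset_insert _ _)
  rintro w (rfl | hw)
  · exact ⟨v, hm hv, hx.symm⟩
  · obtain ⟨u, hu, hwu⟩ := h w (subset_cl S hw)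
    exact ⟨u, hm hu, hwu⟩



lemma nbrs (hcubic : IsCubic G) {v a b c w : V} (ha : G.Adj v a) (hb : G.Adj v b) (hc : G.Adj v c)
    (hab : a ≠ b) (hac : a ≠ c) (hbc : b ≠ c) (hw : G.Adj v w) : w = a ∨ w = b ∨ w = c := by
  have h3 := hcubic v
  have hfin : (G.neighborSet v).Finite := Set.finite_of_ncard_ne_zero (by omega)
  have hsub : ({a, b, c} : Set V) ⊆ G.neighborSet v := by
    rintro _ (rfl | rfl | rfl) <;> assumption
  have hcard : ({a, b, c} : Set V).ncard = 3 := Set.ncard_eq_three.2 ⟨a, b, c, hab, hac, hbc, rfl⟩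
  have := Set.eq_of_subset_of_ncard_le hsub (by omega) hfin
  have hw' : w ∈ G.neighborSet v := hw
  rw [← this] at hw'
  simpa using hw'


lemma third (hcubic : IsCubic G) {v a b : V} : ∃ c, G.Adj v c ∧ c ≠ a ∧ c ≠ b := by
  by_contra! h
  have hsub : G.neighborSet v ⊆ {a, b} := by
    intro c hc
    by_cases hca : c = a
    · simp [hca]
    · simp [h c hc hca]
  have h1 := Set.ncard_le_ncard hsub
  have h2 := Set.ncard_insert_le a {b}
  have h3 := hcubic v
  simp at h2
  omega


lemma force (hcubic : IsCubic G) {S : Set V} {v a b c : V} (hv : v ∈ cl G S) (ha : G.Adj v a) (hb : G.Adj v b)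
    (hc : G.Adj v c)
    (hab : a ≠ b) (hac : a ≠ c) (hbc : b ≠ c) (haS : a ∈ cl G S) (hbS : b ∈ cl G S) :
    c ∈ cl G S := by
  refine cl_closed S v hv c hc fun u hu huS => ?_
  rcases nbrs hcubic ha hb hc hab hac hbc hu with rfl | rfl | rfl
  · exact absurd haS huS
  · exact absurd hbS huS
  · rfl

lemma exists_boundary (hconn : G.Connected) {C : Set V} {v x : V} (hv : v ∈ C) (hx : x ∉ C) :
    ∃ v ∈ C, ∃ x, x ∉ C ∧ G.Adj v x := by
  by_contra! h
  obtain ⟨p⟩ := hconn.preconnected v x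
  have : ∀ {a b : V}, G.Walk a b → a ∈ C → b ∈ C := by
    intro a b p
    induction p with
    | nil => exact id
    | cons hab _ ih => 
      intro ha
      refine ih ?_
      by_contra hb
      exact h _ ha _ hb hab
  exact hx (this p hv)

lemma finish [Finite V] (hcubic : IsCubic G) (hconn : G.Connected) :
    ∀ (k : ℕ) (S : Set V), (cl G S)ᶜ.ncard ≤ k → NoIso G S → 2 * S.ncard < (cl G S).ncard →
      ∃ S', IsForcingSet G S' ∧ 2 * S'.ncard < Nat.card V := by
  intro k
  induction k with
  | zero =>
    intro S h0 hI hS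
    have h0 : (cl G S)ᶜ = ∅ := by
      rw [← Set.ncard_eq_zero]; omega
    have h1 : cl G S = Set.univ := by simpa using h0
    refine ⟨S, fun T hT hc v => ?_, ?_⟩
    · have : v ∈ cl G S := by simp [h1]
      exact this T hT hc
    · rw [h1, Set.ncard_univ] at hS; exact hS
  | succ k ih =>
    intro S hk hI hS
    by_cases h1 : cl G S = Set.univ
    · exact ih S (by simp [h1]) hI hS
    · obtain ⟨x, hx⟩ := (Set.ne_univ_iff_exists_notMem _).1 h1
      obtain ⟨v, hv⟩ : (cl G S).Nonempty := Set.nonempty_of_ncard_ne_zero (by omega)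
      obtain ⟨v, hv, x, hx, hvx⟩ := exists_boundary hconn hv hx
      have hm : cl G S ⊆ cl G (insert x S) := cl_mono (Set.subset_insert _ _)
      obtain ⟨y, hvy, hy, hyx⟩ : ∃ y, G.Adj v y ∧ y ∉ cl G S ∧ y ≠ x := by
        by_contra! h
        exact hx (cl_closed S v hv x hvx h)
      have hx' : x ∈ cl G (insert x S) := subset_cl _ (by simp)
      obtain ⟨u, hu, hvu⟩ := hI v hv
      have hy' : y ∈ cl G (insert x S) :=
        force hcubic (hm hv) hvu hvx hvy (by rintro rfl; exact hx hu) (by rintro rfl; exact hy hu)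
          hyx.symm (hm hu) hx'
      have hsub : insert x (insert y (cl G S)) ⊆ cl G (insert x S) := by
        rintro z (rfl | rfl | hz)
        · exact hx'
        · exact hy'
        · exact hm hz
      have hc := Set.ncard_le_ncard hsub
      rw [Set.ncard_insert_of_notMem (by simp [hx, hyx.symm]),
        Set.ncard_insert_of_notMem hy] at hc
      have h2 := Set.ncard_insert_le x S
      have h3 := Set.ncard_add_ncard_compl (cl G S)
      have h4 := Set.ncard_add_ncard_compl (cl G (insert x S))
      exact ih (insert x S) (by omega) (noIso_insert hI hv hvx) (by omega)

lemma finish' [Finite V] (hcubic : IsCubic G) (hconn : G.Connected) {S : Set V} (hI : NoIso G S)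
    (h : 2 * S.ncard < (cl G S).ncard) : 2 * forcingNumber G < Nat.card V := by
  obtain ⟨S', h1, h2⟩ := finish hcubic hconn _ S le_rfl hI h
  have : forcingNumber G ≤ S'.ncard := Nat.sInf_le ⟨S', h1, rfl⟩
  omega

/-- Adding three new vertices with one new seed. -/
lemma gain3 [Finite V] (hcubic : IsCubic G) (hconn : G.Connected) {S : Set V} (hI : NoIso G S)
    {v p q z : V} (hv : v ∈ cl G S) (hvp : G.Adj v p)
    (hp : p ∉ cl G S) (hq : q ∉ cl G S) (hz : z ∉ cl G S)
    (hpq : p ≠ q) (hpz : p ≠ z) (hqz : q ≠ z)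
    (hq' : q ∈ cl G (insert p S)) (hz' : z ∈ cl G (insert p S))
    (hS : S.ncard ≤ 3) (hC : 6 ≤ (cl G S).ncard) : 2 * forcingNumber G < Nat.card V := by
  have hm : cl G S ⊆ cl G (insert p S) := cl_mono (Set.subset_insert _ _)
  apply finish' hcubic hconn (noIso_insert hI hv hvp)
  have hsub : insert p (insert q (insert z (cl G S))) ⊆ cl G (insert p S) := by
    rintro w (rfl | rfl | rfl | hw)
    · exact subset_cl _ (by simp)
    · exact hq'
    · exact hz'
    · exact hm hw
  have hc := Set.ncard_le_ncard hsub
  rw [Set.ncard_insert_of_notMem (by simp [*]),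
        Set.ncard_insert_of_notMem (by simp [*]), Set.ncard_insert_of_notMem hz] at hc
  have h2 := Set.ncard_insert_le p S
  omega

lemma step [Finite V] (hcubic : IsCubic G) (hconn : G.Connected) {S : Set V} (hI : NoIso G S)
    {v p q p' q' : V} (hv : v ∈ cl G S) (hvp : G.Adj v p) (hvq : G.Adj v q) (hpq : G.Adj p q)
    (hpp : G.Adj p p') (hqq : G.Adj q q') (hp'v : p' ≠ v) (hp'q : p' ≠ q)
    (hq'v : q' ≠ v) (hq'p : q' ≠ p)
    (hp : p ∉ cl G S) (hq : q ∉ cl G S)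
    (hS : S.ncard ≤ 3) (hC : 6 ≤ (cl G S).ncard) :
    2 * forcingNumber G < Nat.card V ∨ (p' = q' ∧ p' ∈ cl G S) := by
  have hm : cl G S ⊆ cl G (insert p S) := cl_mono (Set.subset_insert _ _)
  have hp1 : p ∈ cl G (insert p S) := subset_cl _ (by simp)
  obtain ⟨u, hu, hvu⟩ := hI v hv
  have hup : u ≠ p := by rintro rfl; exact hp hu
  have huq : u ≠ q := by rintro rfl; exact hq hu
  have hq1 : q ∈ cl G (insert p S) :=
    force hcubic (hm hv) hvu hvp hvq hup huq hpq.ne (hm hu) hp1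
  have hp'1 : p' ∈ cl G (insert p S) :=
    force hcubic hp1 hvp.symm hpq hpp hvq.ne hp'v.symm hp'q.symm (hm hv) hq1
  by_cases hp' : p' ∈ cl G S
  · by_cases he : p' = q'
    · exact Or.inr ⟨he, hp'⟩
    · left
      obtain ⟨z, hpz, hz, hzp⟩ : ∃ z, G.Adj p' z ∧ z ∉ cl G S ∧ z ≠ p := by
        by_contra! h
        exact hp (cl_closed S p' hp' p hpp.symm h)
      obtain ⟨w, hw, hpw⟩ := hI p' hp'
      have hz1 : z ∈ cl G (insert p S) :=
        force hcubic (hm hp') hpw hpp.symm hpz (by rintro rfl; exact hp hw)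
          (by rintro rfl; exact hz hw) hzp.symm (hm hw) hp1
      refine gain3 hcubic hconn hI hv hvp hp hq hz hpq.ne hzp.symm ?_ hq1 hz1 hS hC
      rintro rfl
      rcases nbrs hcubic hvq.symm hpq.symm hqq hvp.ne hq'v.symm hq'p.symm hpz.symm with h | h | h
      · exact hp'v h
      · exact hpp.ne h.symm
      · exact he h
  · left
    exact gain3 hcubic hconn hI hv hvp hp hq hp' hpq.ne hpp.ne hp'q.symm hq1 hp'1 hS hC

/-- An injective homomorphism between cubic graphs into a connected one is an isomorphism. -/
lemma iso_of_hom {W : Type*} [Nonempty W] {H : SimpleGraph W} (hcubic : IsCubic G)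
    (hconn : G.Connected) (hH : IsCubic H) (f : W → V) (hf : Function.Injective f)
    (hom : ∀ i j, H.Adj i j → G.Adj (f i) (f j)) : Nonempty (G ≃g H) := by
  have key : ∀ i, f '' H.neighborSet i = G.neighborSet (f i) := by
    intro i
    have hfin : (G.neighborSet (f i)).Finite :=
      Set.finite_of_ncard_ne_zero (by rw [hcubic]; norm_num)
    refine Set.eq_of_subset_of_ncard_le ?_ ?_ hfin
    · rintro _ ⟨j, hj, rfl⟩
      exact hom i j hj
    · rw [Set.ncard_image_of_injective _ hf, hH, hcubic]
  have hsurj : Function.Surjective f := by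
    intro v
    by_contra hv
    obtain ⟨i0⟩ := ‹Nonempty W›
    obtain ⟨_, ⟨i, rfl⟩, x, hx, hix⟩ := exists_boundary hconn (C := Set.range f)
      (Set.mem_range_self i0) (x := v) (by simpa using hv)
    have : x ∈ f '' H.neighborSet i := by rw [key]; exact hix
    obtain ⟨j, -, rfl⟩ := this
    exact hx ⟨j, rfl⟩
  refine ⟨SimpleGraph.Iso.symm ⟨Equiv.ofBijective f ⟨hf, hsurj⟩, ?_⟩⟩
  intro i j
  refine ⟨fun h => ?_, hom i j⟩
  have : f j ∈ f '' H.neighborSet i := by rw [key]; exact h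
  obtain ⟨k, hk, hkj⟩ := this
  rw [← hf hkj]; exact hk

lemma forcing_iso {W : Type*} {H : SimpleGraph W} (e : G ≃g H) {S : Set V}
    (hS : IsForcingSet G S) : IsForcingSet H (e '' S) := by
  intro T hT hc v
  have := hS (e ⁻¹' T) (fun x hx => hT ⟨x, hx, rfl⟩) ?_ (e.symm v)
  · simpa using this
  · intro v hv w hw hu
    refine hc (e v) hv (e w) (e.map_adj_iff.2 hw) fun u hvu huT => ?_
    have := hu (e.symm u) (by rw [← e.map_adj_iff]; simpa using hvu) (by simpa using huT)
    rw [← this]; simp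

lemma forcingNumber_le_iso {W : Type*} {H : SimpleGraph W} (e : G ≃g H) :
    forcingNumber H ≤ forcingNumber G := by
  have hne : {n : ℕ | ∃ S : Set V, IsForcingSet G S ∧ S.ncard = n}.Nonempty :=
    ⟨_, Set.univ, fun T hT _ v => hT (Set.mem_univ v), rfl⟩
  obtain ⟨S, h1, h2⟩ := Nat.sInf_mem hne
  refine Nat.sInf_le ⟨e '' S, forcing_iso e h1, ?_⟩
  rw [Set.ncard_image_of_injective _ e.injective]
  exact h2

lemma forcingNumber_iso {W : Type*} {H : SimpleGraph W} (e : G ≃g H) :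
    forcingNumber G = forcingNumber H :=
  le_antisymm (forcingNumber_le_iso e.symm) (forcingNumber_le_iso e)

end ForcingAux

namespace ForcingAux

instance decNecklace : DecidableRel (diamondNecklace 2).Adj := by
  unfold diamondNecklace; infer_instance

instance decPrism : DecidableRel prism.Adj := fun a b => by
  unfold prism
  rw [SimpleGraph.boxProd_adj, SimpleGraph.cycleGraph_adj]
  infer_instance

lemma cubic_of {W : Type*} [Fintype W] {H : SimpleGraph W} [DecidableRel H.Adj]
    (h : ∀ v, (Finset.univ.filter (H.Adj v)).card = 3) : IsCubic H := by
  intro v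
  rw [← h v, ← Set.ncard_coe_finset]
  congr 1
  ext; simp

lemma cubic_necklace : IsCubic (diamondNecklace 2) := cubic_of (by decide)
lemma cubic_prism : IsCubic prism := cubic_of (by decide)
lemma cubic_K4 : IsCubic (⊤ : SimpleGraph (Fin 4)) := cubic_of (by decide)

/-- The first force. -/
lemma first {W : Type*} {H : SimpleGraph W} {S : Set W} (hS : IsForcingSet H S)
    (hne : ∃ v, v ∉ S) : ∃ v w, H.Adj v w ∧ insert v (H.neighborSet v \ {w}) ⊆ S := by
  by_contra! h
  obtain ⟨v, hv⟩ := hne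
  refine hv (hS S le_rfl ?_ v)
  intro v hv w hw hu
  exfalso
  refine h v w hw ?_
  rintro x (rfl | ⟨hx, hxw⟩)
  · exact hv
  · by_contra hxS
    exact hxw (hu x hx hxS)

lemma ncard_first {W : Type*} {H : SimpleGraph W} (hH : IsCubic H) {v w : W} (h : H.Adj v w) :
    (insert v (H.neighborSet v \ {w})).ncard = 3 := by
  have hfin : (H.neighborSet v).Finite :=
    Set.finite_of_ncard_ne_zero (by rw [hH]; norm_num)
  have : (H.neighborSet v \ {w}).ncard = 2 := by
    rw [Set.ncard_sdiff_singleton_of_mem (by exact h), hH]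
  rw [Set.ncard_insert_of_notMem (by simp) hfin.sdiff, this]

lemma prism_ge {S : Set (Fin 3 × Fin 2)} (hS : IsForcingSet prism S) : 3 ≤ S.ncard := by
  by_cases hne : ∃ v, v ∉ S
  · obtain ⟨v, w, hvw, hsub⟩ := first hS hne
    have h3 := ncard_first cubic_prism hvw
    exact h3.symm.le.trans (Set.ncard_le_ncard hsub)
  · push Not at hne
    rw [Set.eq_univ_of_forall hne, Set.ncard_univ]
    simp

lemma necklace_ge {S : Set (Fin 2 × Fin 4)} (hS : IsForcingSet (diamondNecklace 2) S) :
    4 ≤ S.ncard := by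
  by_contra hlt
  have hpair : ∀ i, (i, 2) ∈ S ∨ (i, 3) ∈ S := by
    intro i
    by_contra! h
    have := hS {v | v ≠ (i, 2) ∧ v ≠ (i, 3)} ?_ ?_ (i, 2)
    · simp at this
    · intro v hv
      constructor <;> rintro rfl
      · exact h.1 hv
      · exact h.2 hv
    · have : ∀ i, ∀ v : Fin 2 × Fin 4, v ≠ (i, 2) ∧ v ≠ (i, 3) → ∀ w, (diamondNecklace 2).Adj v w →
        (∀ u, (diamondNecklace 2).Adj v u → ¬ (u ≠ (i, 2) ∧ u ≠ (i, 3)) → u = w) →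
          w ≠ (i, 2) ∧ w ≠ (i, 3) := by decide
      exact this i
  have hne : ∃ v, v ∉ S := by
    by_contra! hne
    rw [Set.eq_univ_of_forall hne, Set.ncard_univ] at hlt
    simp at hlt
  obtain ⟨v, w, hvw, hsub⟩ := first hS hne
  have h3 := ncard_first cubic_necklace hvw
  have heq := Set.eq_of_subset_of_ncard_le hsub (by omega)
  have hd : ∀ v : Fin 2 × Fin 4, ∃ i, ∀ u, (u = v ∨ (diamondNecklace 2).Adj v u) →
      u ≠ (i, 2) ∧ u ≠ (i, 3) := by decide
  obtain ⟨i, hi⟩ := hd v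
  rw [← heq] at hpair
  rcases hpair i with h | h
  · exact (hi (i, 2) (by rcases h with h | h; exacts [Or.inl h, Or.inr h.1])).1 rfl
  · exact (hi (i, 3) (by rcases h with h | h; exacts [Or.inl h, Or.inr h.1])).2 rfl

lemma forcingNumber_eq {W : Type*} {H : SimpleGraph W} {k : ℕ} (S : Set W)
    (hS : IsForcingSet H S) (hk : S.ncard = k) (h : ∀ S, IsForcingSet H S → k ≤ S.ncard) :
    forcingNumber H = k := by
  apply le_antisymm
  · exact Nat.sInf_le ⟨S, hS, hk⟩
  · refine le_csInf (s := {n : ℕ | ∃ S : Set W, IsForcingSet H S ∧ S.ncard = n}) ⟨_, S, hS, rfl⟩ ?_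
    rintro _ ⟨S, hS, rfl⟩
    exact h S hS

lemma forcingNumber_prism : forcingNumber prism = 3 := by
  refine forcingNumber_eq (({(0, 0), (1, 0), (0, 1)} : Finset (Fin 3 × Fin 2)) : Set (Fin 3 × Fin 2))
    ?_ (by rw [Set.ncard_coe_finset]; decide) fun S => prism_ge
  intro T hT hc
  have h00 : (0, 0) ∈ T := hT (by decide)
  have h10 : (1, 0) ∈ T := hT (by decide)
  have h01 : (0, 1) ∈ T := hT (by decide)
  have h20 : (2, 0) ∈ T := hc (0, 0) h00 _ (by decide) fun u hu hT' => by
    have : ∀ u, prism.Adj (0, 0) u → u = (2, 0) ∨ u = (1, 0) ∨ u = (0, 1) := by decide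
    grind
  have h11 : (1, 1) ∈ T := hc (1, 0) h10 _ (by decide) fun u hu hT' => by
    have : ∀ u, prism.Adj (1, 0) u → u = (1, 1) ∨ u = (0, 0) ∨ u = (2, 0) := by decide
    grind
  have h21 : (2, 1) ∈ T := hc (2, 0) h20 _ (by decide) fun u hu hT' => by
    have : ∀ u, prism.Adj (2, 0) u → u = (2, 1) ∨ u = (0, 0) ∨ u = (1, 0) := by decide
    grind
  rintro ⟨i, j⟩
  fin_cases i <;> fin_cases j <;> assumption

lemma forcingNumber_necklace : forcingNumber (diamondNecklace 2) = 4 := by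
  refine forcingNumber_eq (({(0, 0), (0, 2), (0, 3), (1, 2)} : Finset (Fin 2 × Fin 4)) : Set (Fin 2 × Fin 4))
    ?_ (by rw [Set.ncard_coe_finset]; decide) fun S => necklace_ge
  intro T hT hc
  have h00 : (0, 0) ∈ T := hT (by decide)
  have h02 : (0, 2) ∈ T := hT (by decide)
  have h03 : (0, 3) ∈ T := hT (by decide)
  have h12 : (1, 2) ∈ T := hT (by decide)
  have h01 : (0, 1) ∈ T := hc (0, 2) h02 _ (by decide) fun u hu hT' => by
    have : ∀ u, (diamondNecklace 2).Adj (0, 2) u → u = (0, 1) ∨ u = (0, 0) ∨ u = (0, 3) := by decide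
    grind
  have h11 : (1, 1) ∈ T := hc (0, 0) h00 _ (by decide) fun u hu hT' => by
    have : ∀ u, (diamondNecklace 2).Adj (0, 0) u → u = (1, 1) ∨ u = (0, 2) ∨ u = (0, 3) := by decide
    grind
  have h10 : (1, 0) ∈ T := hc (0, 1) h01 _ (by decide) fun u hu hT' => by
    have : ∀ u, (diamondNecklace 2).Adj (0, 1) u → u = (1, 0) ∨ u = (0, 2) ∨ u = (0, 3) := by decide
    grind
  have h13 : (1, 3) ∈ T := hc (1, 0) h10 _ (by decide) fun u hu hT' => by
    have : ∀ u, (diamondNecklace 2).Adj (1, 0) u → u = (1, 3) ∨ u = (1, 2) ∨ u = (0, 1) := by decide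
    grind
  rintro ⟨i, j⟩
  fin_cases i <;> fin_cases j <;> assumption

end ForcingAux

namespace ForcingAux

variable {V : Type*} {G : SimpleGraph V}

lemma iso_K4 (hcubic : IsCubic G) (hconn : G.Connected) {a b c d : V}
    (hab : G.Adj a b) (hac : G.Adj a c) (had : G.Adj a d)
    (hbc : G.Adj b c) (hbd : G.Adj b d) (hcd : G.Adj c d) :
    Nonempty (G ≃g (⊤ : SimpleGraph (Fin 4))) := by
  have hom : ∀ i j : Fin 4, i ≠ j → G.Adj (![a, b, c, d] i) (![a, b, c, d] j) := by
    intro i j h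
    fin_cases i <;> fin_cases j <;>
      first | exact absurd rfl h | assumption | (apply SimpleGraph.Adj.symm; assumption)
  refine iso_of_hom hcubic hconn cubic_K4 ![a, b, c, d] ?_ (fun i j h => hom i j h)
  intro i j h
  by_contra hij
  exact (hom i j hij).ne h

lemma iso_prism (hcubic : IsCubic G) (hconn : G.Connected) {v x y v' x' y' : V}
    (hvx : G.Adj v x) (hvy : G.Adj v y) (hxy : G.Adj x y)
    (hvx' : G.Adj v' x') (hvy' : G.Adj v' y') (hxy' : G.Adj x' y')
    (hv : G.Adj v v') (hx : G.Adj x x') (hy : G.Adj y y')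
    (h1 : v' ≠ x) (h2 : v' ≠ y) (h3 : x' ≠ v) (h4 : x' ≠ y) (h5 : y' ≠ v) (h6 : y' ≠ x) :
    Nonempty (G ≃g prism) := by
  let f : Fin 3 × Fin 2 → V := fun p => ![![v, v'], ![x, x'], ![y, y']] p.1 p.2
  have hom : ∀ i j, prism.Adj i j → G.Adj (f i) (f j) := by
    rintro ⟨i, j⟩ ⟨k, l⟩ h
    fin_cases i <;> fin_cases j <;> fin_cases k <;> fin_cases l <;>
      first | assumption | (apply SimpleGraph.Adj.symm; assumption) | exact absurd h (by decide)
  refine iso_of_hom hcubic hconn cubic_prism f ?_ hom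
  rintro i j h
  by_contra hij
  by_cases hadj : prism.Adj i j
  · exact (hom i j hadj).ne h
  · revert hadj hij h
    obtain ⟨i, m⟩ := i
    obtain ⟨k, l⟩ := j
    fin_cases i <;> fin_cases m <;> fin_cases k <;> fin_cases l <;> intro h hij hadj <;>
      first
      | exact absurd rfl hij
      | exact h1 h | exact h2 h | exact h3 h | exact h4 h | exact h5 h | exact h6 h
      | exact h1 h.symm | exact h2 h.symm | exact h3 h.symm | exact h4 h.symm
      | exact h5 h.symm | exact h6 h.symm
      | exact absurd (by decide) hadj

lemma iso_necklace (hcubic : IsCubic G) (hconn : G.Connected) {a b c d a' b' p q : V}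
    (hac : G.Adj a c) (had : G.Adj a d) (hbc : G.Adj b c) (hbd : G.Adj b d) (hcd : G.Adj c d)
    (haa : G.Adj a a') (hbb : G.Adj b b')
    (hap : G.Adj a' p) (haq : G.Adj a' q) (hbp : G.Adj b' p) (hbq : G.Adj b' q) (hpq : G.Adj p q)
    (hnd : [a, b, c, d, b', a', p, q].Nodup) :
    Nonempty (G ≃g diamondNecklace 2) := by
  let f : Fin 2 × Fin 4 → V := fun i => ![![a, b, c, d], ![b', a', p, q]] i.1 i.2
  have hom : ∀ i j, (diamondNecklace 2).Adj i j → G.Adj (f i) (f j) := by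
    rintro ⟨i, j⟩ ⟨k, l⟩ h
    fin_cases i <;> fin_cases j <;> fin_cases k <;> fin_cases l <;>
      first | assumption | (apply SimpleGraph.Adj.symm; assumption) | exact absurd h (by decide)
  refine iso_of_hom hcubic hconn cubic_necklace f ?_ hom
  have hinj := List.nodup_iff_injective_get.1 hnd
  have : f = [a, b, c, d, b', a', p, q].get ∘
      (fun i : Fin 2 × Fin 4 => (⟨4 * i.1 + i.2, by
        have := i.1.2; have := i.2.2; simp; omega⟩ : Fin 8)) := by
    funext ⟨i, j⟩
    fin_cases i <;> fin_cases j <;> rfl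
  rw [this]
  apply hinj.comp
  rintro ⟨i, j⟩ ⟨k, l⟩ h
  simp only [Fin.mk.injEq] at h
  ext <;> simp <;> omega

lemma le_ncard_of_list [Finite V] {l : List V} (h : l.Nodup) {C : Set V} (hC : ∀ x ∈ l, x ∈ C) :
    l.length ≤ C.ncard := by
  classical
  rw [← List.toFinset_card_of_nodup h, ← Set.ncard_coe_finset]
  refine Set.ncard_le_ncard ?_ (Set.toFinite C)
  intro x hx
  exact hC x (by simpa using hx)

lemma mem_list_of [Finite V] {l : List V} (h : l.Nodup) {C : Set V} (hC : ∀ x ∈ l, x ∈ C)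
    (hc : C.ncard ≤ l.length) : ∀ x ∈ C, x ∈ l := by
  intro x hx
  by_contra hxl
  have := le_ncard_of_list (l := x :: l) (C := C) (by simp [h, hxl]) (by
    intro y hy
    rcases List.mem_cons.1 hy with rfl | hy
    · exact hx
    · exact hC y hy)
  simp at this
  omega

lemma ncard3_le (a b c : V) : ({a, b, c} : Set V).ncard ≤ 3 := by
  have h1 := Set.ncard_insert_le a {b, c}
  have h2 := Set.ncard_insert_le b {c}
  simp at h2
  omega

lemma caseA [Finite V] (hcubic : IsCubic G) (hconn : G.Connected) (hcf : ClawFree G)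
    {a b c d : V} (hac : G.Adj a c) (had : G.Adj a d) (hbc : G.Adj b c) (hbd : G.Adj b d)
    (hcd : G.Adj c d) (hab : a ≠ b) (hnab : ¬ G.Adj a b) :
    2 * forcingNumber G < Nat.card V ∨ Nonempty (G ≃g diamondNecklace 2) := by
  by_contra! hcon
  obtain ⟨hF, hN⟩ := hcon
  obtain ⟨a', haa, ha'c, ha'd⟩ := third hcubic (v := a) (a := c) (b := d)
  obtain ⟨b', hbb, hb'c, hb'd⟩ := third hcubic (v := b) (a := c) (b := d)
  have Na : ∀ w, G.Adj a w → w = c ∨ w = d ∨ w = a' := fun w =>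
    nbrs hcubic hac had haa hcd.ne ha'c.symm ha'd.symm
  have Nb : ∀ w, G.Adj b w → w = c ∨ w = d ∨ w = b' := fun w =>
    nbrs hcubic hbc hbd hbb hcd.ne hb'c.symm hb'd.symm
  have Nc : ∀ w, G.Adj c w → w = a ∨ w = b ∨ w = d := fun w =>
    nbrs hcubic hac.symm hbc.symm hcd hab had.ne hbd.ne
  have Nd : ∀ w, G.Adj d w → w = a ∨ w = b ∨ w = c := fun w =>
    nbrs hcubic had.symm hbd.symm hcd.symm hab hac.ne hbc.ne
  have ha'a := haa.ne
  have hb'b := hbb.ne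
  have ha'b : a' ≠ b := by rintro rfl; exact hnab haa
  have hb'a : b' ≠ a := by rintro rfl; exact hnab hbb.symm
  have hnc : ¬ G.Adj a' c := fun h => by
    rcases Nc _ h.symm with h | h | h
    exacts [ha'a h.symm, ha'b h, ha'd h]
  have hnd : ¬ G.Adj a' d := fun h => by
    rcases Nd _ h.symm with h | h | h
    exacts [ha'a h.symm, ha'b h, ha'c h]
  have hne' : a' ≠ b' := by
    rintro rfl
    obtain ⟨s, hs, hsa, hsb⟩ := third hcubic (v := a') (a := a) (b := b)
    refine hcf ⟨a', a, b, s, haa.symm, hbb.symm, hs, hab, hsa.symm, hsb.symm, hnab, ?_, ?_⟩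
    · intro h
      rcases Na _ h with rfl | rfl | rfl
      exacts [hnc hs, hnd hs, hs.ne rfl]
    · intro h
      rcases Nb _ h with rfl | rfl | rfl
      exacts [hnc hs, hnd hs, hs.ne rfl]
  have hnb : ¬ G.Adj a' b := fun h => by
    rcases Nb _ h.symm with h | h | h
    exacts [ha'c h, ha'd h, hne' h]
  set S : Set V := {a, c, d} with hS
  have hSc : S.ncard ≤ 3 := ncard3_le _ _ _
  have ma : a ∈ cl G S := subset_cl S (by simp [hS])
  have mc : c ∈ cl G S := subset_cl S (by simp [hS])
  have md : d ∈ cl G S := subset_cl S (by simp [hS])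
  have mb : b ∈ cl G S := force hcubic mc hac.symm hcd hbc.symm had.ne hab hbd.ne.symm ma md
  have ma' : a' ∈ cl G S := force hcubic ma hac had haa hcd.ne ha'c.symm ha'd.symm mc md
  have mb' : b' ∈ cl G S := force hcubic mb hbc hbd hbb hcd.ne hb'c.symm hb'd.symm mc md
  have hI : NoIso G S := by
    apply noIso_of
    rintro v (rfl | rfl | rfl)
    · exact ⟨c, mc, hac⟩
    · exact ⟨d, md, hcd⟩
    · exact ⟨c, mc, hcd.symm⟩
  have hnodup : [a, b, c, d, a', b'].Nodup := by
    have := hac.ne; have := had.ne; have := hbc.ne; have := hbd.ne; have := hcd.ne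
    simp; grind
  have hmem : ∀ x ∈ [a, b, c, d, a', b'], x ∈ cl G S := by
    intro w hw
    simp only [List.mem_cons, List.not_mem_nil, or_false] at hw
    rcases hw with rfl | rfl | rfl | rfl | rfl | rfl
    exacts [ma, mb, mc, md, ma', mb']
  have hC6 := le_ncard_of_list hnodup hmem
  have hCle : (cl G S).ncard ≤ 6 := by
    by_contra hlt
    have := finish' hcubic hconn hI (by omega)
    omega
  have hCl := mem_list_of hnodup hmem hCle
  obtain ⟨p, hap, hpa, -⟩ := third hcubic (v := a') (a := a) (b := a)
  obtain ⟨q, haq, hqa, hqp⟩ := third hcubic (v := a') (a := a) (b := p)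
  have hnotb : ¬ G.Adj a' b' := by
    intro h
    obtain ⟨s, has, hsa, hsb⟩ := third hcubic (v := a') (a := a) (b := b')
    have ms : s ∈ cl G S := force hcubic ma' haa.symm h has hb'a.symm hsa.symm hsb.symm ma mb'
    have := hCl s ms
    simp only [List.mem_cons, List.not_mem_nil, or_false] at this
    rcases this with rfl | rfl | rfl | rfl | rfl | rfl
    exacts [hsa rfl, hnb has, hnc has, hnd has, has.ne rfl, hsb rfl]
  have hout : ∀ s, G.Adj a' s → s ≠ a → s ∉ cl G S := by
    intro s has hsa ms
    have := hCl s ms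
    simp only [List.mem_cons, List.not_mem_nil, or_false] at this
    rcases this with rfl | rfl | rfl | rfl | rfl | rfl
    exacts [hsa rfl, hnb has, hnc has, hnd has, has.ne rfl, hnotb has]
  have hp := hout p hap hpa
  have hq := hout q haq hqa
  have hnap : ∀ s, G.Adj a' s → ¬ G.Adj a s := by
    intro s has h
    rcases Na _ h with rfl | rfl | rfl
    exacts [hnc has, hnd has, has.ne rfl]
  have hpq : G.Adj p q := by
    by_contra h
    exact hcf ⟨a', a, p, q, haa.symm, hap, haq, hpa.symm, hqa.symm, hqp.symm, hnap p hap,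
      hnap q haq, h⟩
  obtain ⟨p', hpp, hp'a, hp'q⟩ := third hcubic (v := p) (a := a') (b := q)
  obtain ⟨q', hqq, hq'a, hq'p⟩ := third hcubic (v := q) (a := a') (b := p)
  rcases step hcubic hconn hI ma' hap haq hpq hpp hqq hp'a hp'q hq'a hq'p hp hq hSc
    (by simpa using hC6) with h | ⟨rfl, hp'⟩
  · omega
  have hb : p' = b' := by
    have := hCl p' hp'
    simp only [List.mem_cons, List.not_mem_nil, or_false] at this
    have hpin : ∀ s ∈ cl G S, p ≠ s := by rintro s hs rfl; exact hp hs
    rcases this with rfl | rfl | rfl | rfl | rfl | rfl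
    · rcases Na _ hpp.symm with h | h | h
      exacts [absurd h (hpin _ mc), absurd h (hpin _ md), absurd h (hpin _ ma')]
    · rcases Nb _ hpp.symm with h | h | h
      exacts [absurd h (hpin _ mc), absurd h (hpin _ md), absurd h (hpin _ mb')]
    · rcases Nc _ hpp.symm with h | h | h
      exacts [absurd h (hpin _ ma), absurd h (hpin _ mb), absurd h (hpin _ md)]
    · rcases Nd _ hpp.symm with h | h | h
      exacts [absurd h (hpin _ ma), absurd h (hpin _ mb), absurd h (hpin _ mc)]
    · exact absurd rfl hp'a
    · rfl
  subst hb
  refine hN.false (Classical.choice (iso_necklace hcubic hconn hac had hbc hbd hcd haa hbb hap haq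
    hpp.symm hqq.symm hpq ?_))
  have := hac.ne; have := had.ne; have := hbc.ne; have := hbd.ne; have := hcd.ne
  simp; grind

lemma caseB_aux [Finite V] (hcubic : IsCubic G) (hconn : G.Connected) (hcf : ClawFree G)
    (hdia : ∀ a b c d, G.Adj a c → G.Adj a d → G.Adj b c → G.Adj b d → G.Adj c d → a = b)
    {S : Set V} (hI : NoIso G S) (hS : S.ncard ≤ 3) (hC : 6 ≤ (cl G S).ncard)
    {v x y v' p : V} (hvx : G.Adj v x) (hvy : G.Adj v y) (hvv : G.Adj v v')
    (hxy : x ≠ y) (hx : v' ≠ x) (hy : v' ≠ y)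
    (mv : v ∈ cl G S) (mx : x ∈ cl G S) (my : y ∈ cl G S) (mv' : v' ∈ cl G S) 
    (hp : p ∉ cl G S) (hvp : G.Adj v' p) : 2 * forcingNumber G < Nat.card V := by
  have Nv : ∀ w, G.Adj v w → w = x ∨ w = y ∨ w = v' := fun w =>
    nbrs hcubic hvx hvy hvv hxy hx.symm hy.symm
  have hpv : v ≠ p := by rintro rfl; exact hp mv
  obtain ⟨q, hvq, hqv, hqp⟩ := third hcubic (v := v') (a := v) (b := p)
  have hq : q ∉ cl G S := fun mq =>
    hp (force hcubic mv' hvv.symm hvq hvp hqv.symm hpv hqp mv mq)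
  have hn : ∀ s, s ∉ cl G S → ¬ G.Adj v s := by
    intro s hs h
    rcases Nv _ h with rfl | rfl | rfl
    exacts [hs mx, hs my, hs mv']
  have hpq : G.Adj p q := by
    by_contra h
    exact hcf ⟨v', v, p, q, hvv.symm, hvp, hvq, hpv, hqv.symm, hqp.symm, hn p hp, hn q hq, h⟩
  obtain ⟨p', hpp, hp'a, hp'q⟩ := third hcubic (v := p) (a := v') (b := q)
  obtain ⟨q', hqq, hq'a, hq'p⟩ := third hcubic (v := q) (a := v') (b := p)
  rcases step hcubic hconn hI mv' hvp hvq hpq hpp hqq hp'a hp'q hq'a hq'p hp hq hS hC with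
    h | ⟨rfl, hp'⟩
  · exact h
  · exact absurd (hdia p' v' p q hpp.symm hqq.symm hvp hvq hpq) hp'a

lemma caseB [Finite V] (hcubic : IsCubic G) (hconn : G.Connected) (hcf : ClawFree G)
    (hdia : ∀ a b c d, G.Adj a c → G.Adj a d → G.Adj b c → G.Adj b d → G.Adj c d → a = b)
    {v x y : V} (hvx : G.Adj v x) (hvy : G.Adj v y) (hxy : G.Adj x y) :
    2 * forcingNumber G < Nat.card V ∨ Nonempty (G ≃g prism) := by
  by_contra! hcon
  obtain ⟨hF, hN⟩ := hcon
  obtain ⟨v', hvv, hv'x, hv'y⟩ := third hcubic (v := v) (a := x) (b := y)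
  obtain ⟨x', hxx, hx'v, hx'y⟩ := third hcubic (v := x) (a := v) (b := y)
  obtain ⟨y', hyy, hy'v, hy'x⟩ := third hcubic (v := y) (a := v) (b := x)
  have n1 : v' ≠ x' := by
    rintro rfl; exact hv'y (hdia v' y v x hvv.symm hxx.symm hvy.symm hxy.symm hvx)
  have n2 : v' ≠ y' := by
    rintro rfl; exact hv'x (hdia v' x v y hvv.symm hyy.symm hvx.symm hxy hvy)
  have n3 : x' ≠ y' := by
    rintro rfl; exact hx'v (hdia x' v x y hxx.symm hyy.symm hvx hvy hxy)
  have Nv : ∀ w, G.Adj v w → w = x ∨ w = y ∨ w = v' := fun w =>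
    nbrs hcubic hvx hvy hvv hxy.ne hv'x.symm hv'y.symm
  have Nx : ∀ w, G.Adj x w → w = v ∨ w = y ∨ w = x' := fun w =>
    nbrs hcubic hvx.symm hxy hxx hvy.ne hx'v.symm hx'y.symm
  have Ny : ∀ w, G.Adj y w → w = v ∨ w = x ∨ w = y' := fun w =>
    nbrs hcubic hvy.symm hxy.symm hyy hvx.ne hy'v.symm hy'x.symm
  set S : Set V := {v, x, v'} with hS
  have hSc : S.ncard ≤ 3 := ncard3_le _ _ _
  have mv : v ∈ cl G S := subset_cl S (by simp [hS])
  have mx : x ∈ cl G S := subset_cl S (by simp [hS])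
  have mv' : v' ∈ cl G S := subset_cl S (by simp [hS])
  have my : y ∈ cl G S := force hcubic mv hvx hvv hvy hv'x.symm hxy.ne hv'y mx mv'
  have mx' : x' ∈ cl G S := force hcubic mx hvx.symm hxy hxx hvy.ne hx'v.symm hx'y.symm mv my
  have my' : y' ∈ cl G S :=
    force hcubic my hvy.symm hxy.symm hyy hvx.ne hy'v.symm hy'x.symm mv mx
  have hI : NoIso G S := by
    apply noIso_of
    rintro w (rfl | rfl | rfl)
    · exact ⟨x, mx, hvx⟩
    · exact ⟨v, mv, hvx.symm⟩
    · exact ⟨v, mv, hvv.symm⟩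
  have hnodup : [v, x, y, v', x', y'].Nodup := by
    have := hvx.ne; have := hvy.ne; have := hxy.ne; have := hvv.ne; have := hxx.ne
    have := hyy.ne
    simp; grind
  have hmem : ∀ w ∈ [v, x, y, v', x', y'], w ∈ cl G S := by
    intro w hw
    simp only [List.mem_cons, List.not_mem_nil, or_false] at hw
    rcases hw with rfl | rfl | rfl | rfl | rfl | rfl
    exacts [mv, mx, my, mv', mx', my']
  have hC6 : 6 ≤ (cl G S).ncard := le_ncard_of_list hnodup hmem
  have hCle : (cl G S).ncard ≤ 6 := by
    by_contra hlt
    have := finish' hcubic hconn hI (by omega)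
    omega
  have hCl := mem_list_of hnodup hmem hCle
  have iv : ∀ p, G.Adj v' p → p ∈ cl G S := by
    intro p hvp
    by_contra hp
    have := caseB_aux hcubic hconn hcf hdia hI hSc hC6 hvx hvy hvv hxy.ne hv'x hv'y mv mx my mv'
      hp hvp
    omega
  have ix : ∀ p, G.Adj x' p → p ∈ cl G S := by
    intro p hvp
    by_contra hp
    have := caseB_aux hcubic hconn hcf hdia hI hSc hC6 hvx.symm hxy hxx hvy.ne hx'v hx'y mx mv my
      mx' hp hvp
    omega
  have jv : ∀ p, G.Adj v' p → p = v ∨ p = x' ∨ p = y' := by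
    intro p h
    have := hCl p (iv p h)
    simp only [List.mem_cons, List.not_mem_nil, or_false] at this
    rcases this with e | e | e | e | e | e
    · exact Or.inl e
    · rcases Nx v' (e ▸ h.symm) with e' | e' | e'
      exacts [absurd e'.symm hvv.ne, absurd e' hv'y, absurd e' n1]
    · rcases Ny v' (e ▸ h.symm) with e' | e' | e'
      exacts [absurd e'.symm hvv.ne, absurd e' hv'x, absurd e' n2]
    · exact absurd e.symm h.ne
    · exact Or.inr (Or.inl e)
    · exact Or.inr (Or.inr e)
  have jx : ∀ p, G.Adj x' p → p = x ∨ p = v' ∨ p = y' := by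
    intro p h
    have := hCl p (ix p h)
    simp only [List.mem_cons, List.not_mem_nil, or_false] at this
    rcases this with e | e | e | e | e | e
    · rcases Nv x' (e ▸ h.symm) with e' | e' | e'
      exacts [absurd e'.symm hxx.ne, absurd e' hx'y, absurd e'.symm n1]
    · exact Or.inl e
    · rcases Ny x' (e ▸ h.symm) with e' | e' | e'
      exacts [absurd e' hx'v, absurd e'.symm hxx.ne, absurd e' n3]
    · exact Or.inr (Or.inl e)
    · exact absurd e.symm h.ne
    · exact Or.inr (Or.inr e)
  have hvx' : G.Adj v' x' := by
    obtain ⟨s, h, h1, h2⟩ := third hcubic (v := v') (a := v) (b := y')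
    rcases jv s h with rfl | rfl | rfl
    exacts [absurd rfl h1, h, absurd rfl h2]
  have hvy' : G.Adj v' y' := by
    obtain ⟨s, h, h1, h2⟩ := third hcubic (v := v') (a := v) (b := x')
    rcases jv s h with rfl | rfl | rfl
    exacts [absurd rfl h1, absurd rfl h2, h]
  have hxy' : G.Adj x' y' := by
    obtain ⟨s, h, h1, h2⟩ := third hcubic (v := x') (a := x) (b := v')
    rcases jx s h with rfl | rfl | rfl
    exacts [absurd rfl h1, absurd rfl h2, h]
  exact hN.false (Classical.choice (iso_prism hcubic hconn hvx hvy hxy hvx' hvy' hxy' hvv hxx hyy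
    hv'x hv'y hx'v hx'y hy'v hy'x))

end ForcingAux

/-- If `G ≠ K₄` is a connected, claw-free, cubic graph of order `n`, then
`F(G) = n/2` if and only if `G` is the diamond-necklace `N₂` or the prism `C₃ □ K₂`. -/
theorem forcingNumber_eq_half_iff {V : Type*} [Fintype V]
    (G : SimpleGraph V) (hconn : G.Connected) (hcf : ClawFree G) (hcubic : IsCubic G)
    (hK4 : ¬ Nonempty (G ≃g (⊤ : SimpleGraph (Fin 4)))) :
    2 * forcingNumber G = Fintype.card V ↔
      (Nonempty (G ≃g diamondNecklace 2) ∨ Nonempty (G ≃g prism)) := by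

  open ForcingAux in
  constructor
  · intro h
    by_contra! hcon
    have hnlt : ¬ 2 * forcingNumber G < Nat.card V := by
      rw [Nat.card_eq_fintype_card]; omega
    by_cases hdia : ∀ a b c d, G.Adj a c → G.Adj a d → G.Adj b c → G.Adj b d → G.Adj c d → a = b
    · obtain ⟨v⟩ := hconn.nonempty
      obtain ⟨a, ha, -, -⟩ := third hcubic (v := v) (a := v) (b := v)
      obtain ⟨b, hb, hba, -⟩ := third hcubic (v := v) (a := a) (b := a)
      obtain ⟨c, hc, hca, hcb⟩ := third hcubic (v := v) (a := a) (b := b)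
      obtain ⟨x, y, hx, hy, hxy⟩ : ∃ x y, G.Adj v x ∧ G.Adj v y ∧ G.Adj x y := by
        by_contra! hno
        exact hcf ⟨v, a, b, c, ha, hb, hc, hba.symm, hca.symm, hcb.symm, hno a b ha hb,
          hno a c ha hc, hno b c hb hc⟩
      rcases caseB hcubic hconn hcf hdia hx hy hxy with h1 | ⟨⟨e⟩⟩
      · exact hnlt h1
      · exact hcon.2.false e
    · push Not at hdia
      obtain ⟨a, b, c, d, hac, had, hbc, hbd, hcd, hab⟩ := hdia
      have hnab : ¬ G.Adj a b := fun hadj =>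
        hK4 (iso_K4 hcubic hconn hadj hac had hbc hbd hcd)
      rcases caseA hcubic hconn hcf hac had hbc hbd hcd hab hnab with h1 | ⟨⟨e⟩⟩
      · exact hnlt h1
      · exact hcon.1.false e
  · rintro (⟨⟨e⟩⟩ | ⟨⟨e⟩⟩)
    · rw [forcingNumber_iso e, forcingNumber_necklace, Fintype.card_congr e.toEquiv]
      simp
    · rw [forcingNumber_iso e, forcingNumber_prism, Fintype.card_congr e.toEquiv]
      simp
end

section
/- If G is a connected, claw-free, cubic graph of order n ≥ 10, then F(G) < n/2. -/
/-- `v` has exactly the three distinct neighbors `a`, `b`, `c`. -/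
def Nb {V : Type*} (G : SimpleGraph V) (v a b c : V) : Prop :=
  a ≠ b ∧ a ≠ c ∧ b ≠ c ∧ ∀ u, G.Adj v u ↔ u = a ∨ u = b ∨ u = c

/-- `T` is obtained by forcing from `S`, and no vertex of `T` is isolated in `T`. -/
def Good {V : Type*} (G : SimpleGraph V) (S T : Finset V) : Prop :=
  (∀ C : Set V, (∀ v ∈ S, v ∈ C) → ForcingClosed G C → ∀ v ∈ T, v ∈ C) ∧
    ∀ v ∈ T, ∃ w ∈ T, G.Adj v w

/-- A state with a surplus. -/
def Win {V : Type*} (G : SimpleGraph V) : Prop :=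
  ∃ S T : Finset V, Good G S T ∧ 2 * S.card < T.card

section aux
variable {V : Type*} {G : SimpleGraph V}

theorem Nb.rot {v a b c : V} (h : Nb G v a b c) : Nb G v b c a := by
  obtain ⟨h1, h2, h3, h4⟩ := h
  exact ⟨h3, h1.symm, h2.symm, fun u => by rw [h4]; tauto⟩

theorem Nb.swap {v a b c : V} (h : Nb G v a b c) : Nb G v b a c := by
  obtain ⟨h1, h2, h3, h4⟩ := h
  exact ⟨h1.symm, h3, h2, fun u => by rw [h4]; tauto⟩

theorem exists_nb (hc : IsCubic G) (v : V) : ∃ a b c, Nb G v a b c := by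
  obtain ⟨a, b, c, h1, h2, h3, h⟩ := Set.ncard_eq_three.1 (hc v)
  refine ⟨a, b, c, h1, h2, h3, fun u => ?_⟩
  rw [← SimpleGraph.mem_neighborSet, h]; simp

theorem exists_nb1 (hc : IsCubic G) {v a : V} (h : G.Adj v a) : ∃ b c, Nb G v a b c := by
  obtain ⟨x, y, z, hN⟩ := exists_nb hc v
  rcases (hN.2.2.2 a).1 h with rfl | rfl | rfl
  · exact ⟨_, _, hN⟩
  · exact ⟨_, _, hN.rot⟩
  · exact ⟨_, _, hN.rot.rot⟩

theorem exists_nb2 (hc : IsCubic G) {v a b : V} (h : G.Adj v a) (h' : G.Adj v b) (hab : a ≠ b) :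
    ∃ c, Nb G v a b c := by
  obtain ⟨y, z, hN⟩ := exists_nb1 hc h
  rcases (hN.2.2.2 b).1 h' with rfl | rfl | rfl
  · exact absurd rfl hab
  · exact ⟨_, hN⟩
  · exact ⟨_, hN.rot.rot.swap⟩

theorem claw (hcf : ClawFree G) {v a b c : V} (h : Nb G v a b c) :
    G.Adj a b ∨ G.Adj a c ∨ G.Adj b c := by
  obtain ⟨h1, h2, h3, h4⟩ := h
  by_contra hne
  push Not at hne
  exact hcf ⟨v, a, b, c, by simp [h4], by simp [h4], by simp [h4], h1, h2, h3, hne.1, hne.2.1,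
    hne.2.2⟩

theorem exists_boundary (hconn : G.Connected) (T : Finset V) {x y : V} (hx : x ∈ T) (hy : y ∉ T) :
    ∃ v ∈ T, ∃ w, w ∉ T ∧ G.Adj v w := by
  by_contra hne
  push Not at hne
  obtain ⟨p⟩ := hconn.preconnected x y
  induction p with
  | nil => exact hy hx
  | cons h p ih =>
    refine ih ?_ hy
    by_contra hh
    exact hne _ hx _ hh h

variable [DecidableEq V]

theorem Good.force {S T : Finset V} (h : Good G S T) {v w : V} (hv : v ∈ T) (hvw : G.Adj v w)
    (hu : ∀ u, G.Adj v u → u ∉ T → u = w) : Good G S (insert w T) := by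
  refine ⟨fun C hS hC x hx => ?_, fun x hx => ?_⟩
  · have hT := h.1 C hS hC
    rcases Finset.mem_insert.1 hx with rfl | hx
    · exact hC v (hT v hv) x hvw fun u hvu huC => hu u hvu fun h' => huC (hT u h')
    · exact hT x hx
  · rcases Finset.mem_insert.1 hx with rfl | hx
    · exact ⟨v, by simp [hv], hvw.symm⟩
    · obtain ⟨w', h1, h2⟩ := h.2 x hx
      exact ⟨w', by simp [h1], h2⟩

theorem Good.add {S T : Finset V} (h : Good G S T) {v w : V} (hv : v ∈ T) (hvw : G.Adj v w) :
    Good G (insert w S) (insert w T) := by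
  refine ⟨fun C hS hC x hx => ?_, fun x hx => ?_⟩
  · have hT := h.1 C (fun v hv => hS v (by simp [hv])) hC
    rcases Finset.mem_insert.1 hx with rfl | hx
    · exact hS x (by simp)
    · exact hT x hx
  · rcases Finset.mem_insert.1 hx with rfl | hx
    · exact ⟨v, by simp [hv], hvw.symm⟩
    · obtain ⟨w', h1, h2⟩ := h.2 x hx
      exact ⟨w', by simp [h1], h2⟩

theorem finish [Fintype V] (hconn : G.Connected) (hc : IsCubic G) (k : ℕ) :
    ∀ S T : Finset V, Good G S T → 2 * S.card < T.card → Fintype.card V ≤ T.card + k →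
    ∃ S : Finset V, Good G S Finset.univ ∧ 2 * S.card < Fintype.card V := by
  induction k with
  | zero =>
    intro S T hG h1 h2
    have : T = Finset.univ := by
      rw [← Finset.card_eq_iff_eq_univ]
      exact le_antisymm (Finset.card_le_univ T) h2
    subst this
    exact ⟨S, hG, h1⟩
  | succ k ih =>
    intro S T hG h1 h2
    by_cases hT : T = Finset.univ
    · subst hT
      exact ⟨S, hG, h1⟩
    obtain ⟨y, hy⟩ : ∃ y, y ∉ T := by
      by_contra hne
      push Not at hne
      exact hT (Finset.eq_univ_iff_forall.2 hne)
    obtain ⟨x, hx⟩ : T.Nonempty := Finset.card_pos.1 (by omega)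
    obtain ⟨v, hv, w, hw, hvw⟩ := exists_boundary hconn T hx hy
    obtain ⟨u, hu, hvu⟩ := hG.2 v hv
    obtain ⟨p, hN⟩ := exists_nb2 hc hvu hvw (by rintro rfl; exact hw hu)
    obtain ⟨n1, n2, n3, n4⟩ := hN
    by_cases hp : p ∈ T
    · refine ih S (insert w T) (hG.force hv hvw ?_) ?_ ?_
      · grind
      · rw [Finset.card_insert_of_notMem hw]; omega
      · rw [Finset.card_insert_of_notMem hw]; omega
    · have hp' : p ∉ insert w T := by grind
      have hcS := Finset.card_insert_le w S
      refine ih (insert w S) (insert p (insert w T))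
        ((hG.add hv hvw).force (v := v) (by grind) (by grind) (by grind)) ?_ ?_
      · rw [Finset.card_insert_of_notMem hp', Finset.card_insert_of_notMem hw]; omega
      · rw [Finset.card_insert_of_notMem hp', Finset.card_insert_of_notMem hw]; omega

theorem win_force {S T : Finset V} (h : Good G S T) (hd : 2 * S.card ≤ T.card)
    {v w : V} (hv : v ∈ T) (hvw : G.Adj v w) (hw : w ∉ T)
    (hu : ∀ u, G.Adj v u → u ∉ T → u = w) : Win G := by
  refine ⟨S, insert w T, h.force hv hvw hu, ?_⟩
  rw [Finset.card_insert_of_notMem hw]; omega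

theorem win_step {S T : Finset V} (h : Good G S T) (hd : 2 * S.card ≤ T.card)
    {v u p q p' : V} (hv : v ∈ T) (hu : u ∈ T) (hN : Nb G v u p q) (hp : p ∉ T) (hq : q ∉ T)
    (hP : Nb G p v q p') (hp' : p' ∉ T) : Win G := by
  obtain ⟨n1, n2, n3, n4⟩ := hN
  obtain ⟨m1, m2, m3, m4⟩ := hP
  have hpp : G.Adj p p' := by grind
  have hne := hpp.ne
  have e1 : q ∉ insert p T := by grind
  have e2 : p' ∉ insert q (insert p T) := by grind
  have hcS := Finset.card_insert_le p S
  refine ⟨insert p S, insert p' (insert q (insert p T)),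
    (((h.add hv (by grind)).force (v := v) (by grind) (by grind) (by grind)).force (v := p)
      (by grind) hpp (by grind)), ?_⟩
  rw [Finset.card_insert_of_notMem e2, Finset.card_insert_of_notMem e1,
    Finset.card_insert_of_notMem hp]
  omega

/-- Either we win or both third neighbors lie in `T`. -/
theorem win_or (hc : IsCubic G) {S T : Finset V} (h : Good G S T) (hd : 2 * S.card ≤ T.card)
    {v u p q : V} (hv : v ∈ T) (hu : u ∈ T) (hN : Nb G v u p q) (hp : p ∉ T) (hq : q ∉ T)
    (hpq : G.Adj p q) : Win G ∨ ∃ p' q', p' ∈ T ∧ q' ∈ T ∧ Nb G p v q p' ∧ Nb G q v p q' := by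
  have hpv : G.Adj p v := ((hN.2.2.2 p).2 (by simp)).symm
  have hqv : G.Adj q v := ((hN.2.2.2 q).2 (by simp)).symm
  obtain ⟨p', hP⟩ := exists_nb2 hc hpv hpq (by rintro rfl; exact hq hv)
  obtain ⟨q', hQ⟩ := exists_nb2 hc hqv hpq.symm (by rintro rfl; exact hp hv)
  by_cases h1 : p' ∈ T
  · by_cases h2 : q' ∈ T
    · exact .inr ⟨p', q', h1, h2, hP, hQ⟩
    · exact .inl (win_step h hd hv hu hN.rot.swap.rot.rot hq hp hQ h2)
  · exact .inl (win_step h hd hv hu hN hp hq hP h1)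

theorem good_tri {x y z : V} (h1 : G.Adj x y) (h2 : G.Adj x z) :
    Good G {x, y, z} {x, y, z} := by
  refine ⟨fun C hS _ => hS, fun v hv => ?_⟩
  have := h1.symm
  have := h2.symm
  grind

theorem no_closed [Fintype V] (hconn : G.Connected) (hn : 10 ≤ Fintype.card V) (T : Finset V) {x : V} (hx : x ∈ T)
    (hT : T.card < 10) (h : ∀ v ∈ T, ∀ w, G.Adj v w → w ∈ T) : False := by
  obtain ⟨y, hy⟩ : ∃ y, y ∉ T := by
    by_contra hne
    push Not at hne
    rw [Finset.eq_univ_iff_forall.2 hne, Finset.card_univ] at hT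
    omega
  obtain ⟨v, hv, w, hw, hvw⟩ := exists_boundary hconn T hx hy
  exact hw (h v hv w hvw)

theorem cls (hcf : ClawFree G) (hc : IsCubic G) {S T : Finset V} (h : Good G S T)
    (hd : 2 * S.card ≤ T.card) {v u : V} (hv : v ∈ T) (hu : u ∈ T) (hvu : G.Adj v u)
    (hus : ∀ w, G.Adj u w → w ∈ T) :
    Win G ∨ (∀ w, G.Adj v w → w ∈ T) ∨ ∃ p q p' q', p ∉ T ∧ q ∉ T ∧ Nb G v u p q ∧
      p' ∈ T ∧ q' ∈ T ∧ Nb G p v q p' ∧ Nb G q v p q' := by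
  obtain ⟨p, q, hN⟩ := exists_nb1 hc hvu
  obtain ⟨n1, n2, n3, n4⟩ := id hN
  by_cases hp : p ∈ T
  · by_cases hq : q ∈ T
    · right; left; intro w hw
      rcases (n4 w).1 hw with rfl | rfl | rfl <;> assumption
    · left
      exact win_force h hd hv ((n4 q).2 (by simp)) hq (by grind)
  · by_cases hq : q ∈ T
    · left
      exact win_force h hd hv ((n4 p).2 (by simp)) hp (by grind)
    · have hpq : G.Adj p q := by
        rcases claw hcf hN with h1 | h1 | h1
        · exact absurd (hus _ h1) hp
        · exact absurd (hus _ h1) hq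
        · exact h1
      rcases win_or hc h hd hv hu hN hp hq hpq with h1 | ⟨p', q', h1, h2, h3, h4⟩
      · exact .inl h1
      · exact .inr (.inr ⟨p, q, p', q', hp, hq, hN, h1, h2, h3, h4⟩)

theorem caseA2 [Fintype V] (hconn : G.Connected) (hcf : ClawFree G) (hc : IsCubic G)
    (hn : 10 ≤ Fintype.card V) {S T : Finset V} (h : Good G S T)
    (hd : 2 * S.card ≤ T.card) {x y z x' y' z' p q q' : V}
    (hT : ∀ v, v ∈ T ↔ v = x ∨ v = y ∨ v = z ∨ v = x' ∨ v = y' ∨ v = z')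
    (hcard : T.card = 6)
    (hx : Nb G x y z x') (hy : Nb G y x z y') (hz : Nb G z x y z')
    (hxy : x' ≠ y') (hxz : x' ≠ z') (hyz : y' ≠ z')
    (hp : p ∉ T) (hq : q ∉ T) (hx' : Nb G x' x p q) (hP : Nb G p x' q y') (hQ : Nb G q x' p q') :
    Win G := by
  have sx : ∀ w, G.Adj x w → w ∈ T := fun w hw => by
    rw [hx.2.2.2] at hw; rw [hT]; tauto
  have sy : ∀ w, G.Adj y w → w ∈ T := fun w hw => by
    rw [hy.2.2.2] at hw; rw [hT]; tauto
  have sz : ∀ w, G.Adj z w → w ∈ T := fun w hw => by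
    rw [hz.2.2.2] at hw; rw [hT]; tauto
  have ay : G.Adj y' y := ((hy.2.2.2 y').2 (by simp)).symm
  have az : G.Adj z' z := ((hz.2.2.2 z').2 (by simp)).symm
  have apy : G.Adj p y' := (hP.2.2.2 y').2 (by simp)
  rcases cls hcf hc h hd (v := y') (u := y) (by simp [hT]) (by simp [hT]) ay sy with
    h1 | h1 | ⟨p2, q2, p2', q2', h1, h2, h3, h4, h5, h6, h7⟩
  · exact h1
  · exact absurd (h1 p apy.symm) hp
  have hq2 : ∀ w, G.Adj q w → w = x' ∨ w = p ∨ w = y' := by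
    intro w hw
    have e1 := (h3.2.2.2 p).1 apy.symm
    have hyp : y ≠ p := fun e => hp (by simp [← e, hT])
    have hyT : x' ∈ T := by simp [hT]
    have hyT' : y' ∈ T := by simp [hT]
    have e3 := hP.2.2.2
    have e4 := hQ.2.2.2
    have e5 := h6.2.2.2
    have e6 := h7.2.2.2
    have e7 := h3.2.2.2
    have e8 : q = p2 ∨ q = q2 := by
      rcases e1 with e | e | e
      · exact absurd e.symm hyp
      · right
        have := (e3 q2).1 (by rw [e]; exact (e5 q2).2 (by simp))
        grind
      · left
        have := (e3 p2).1 (by rw [e]; exact (e6 p2).2 (by simp))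
        grind
    have e9 : G.Adj q y' := by
      apply SimpleGraph.Adj.symm
      rw [e7]; tauto
    have := (e4 y').1 e9
    grind
  have hy2 : ∀ w, G.Adj y' w → w = y ∨ w = p ∨ w = q := by
    have e7 := h3.2.2.2
    have hyp : y ≠ p := fun e => hp (by simp [← e, hT])
    have hyq : y ≠ q := fun e => hq (by simp [← e, hT])
    have e9 : G.Adj q y' := by
      have := hq2 q' ((hQ.2.2.2 q').2 (by simp))
      have := hQ.1
      have := hQ.2.1
      have := hQ.2.2.1
      have := (hQ.2.2.2 q').2 (by simp)
      grind
    have hpq := hx'.2.2.1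
    have := (e7 p).1 apy.symm
    have := (e7 q).1 e9.symm
    grind
  rcases cls hcf hc h hd (v := z') (u := z) (by simp [hT]) (by simp [hT]) az sz with
    g1 | g1 | ⟨p3, q3, p3', q3', g1, g2, g3, g4, g5, g6, g7⟩
  · exact g1
  · exfalso
    refine no_closed hconn hn (insert p (insert q T)) (x := p) (by simp) ?_ ?_
    · have := Finset.card_insert_le p (insert q T)
      have := Finset.card_insert_le q T
      omega
    · have e1 := hP.2.2.2
      have e2 := hx'.2.2.2
      intro v hv w hw
      simp only [Finset.mem_insert] at hv ⊢
      rcases hv with rfl | rfl | hv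
      · grind
      · grind
      · rcases (hT v).1 hv with rfl | rfl | rfl | rfl | rfl | rfl
        · exact .inr (.inr (sx _ hw))
        · exact .inr (.inr (sy _ hw))
        · exact .inr (.inr (sz _ hw))
        · grind
        · grind
        · exact .inr (.inr (g1 _ hw))
  · exfalso
    have a1 : G.Adj p3 p3' := (g6.2.2.2 p3').2 (by simp)
    have a2 : G.Adj p3 z' := (g6.2.2.2 z').2 (by simp)
    have hne := g6.2.1
    have zT : z' ∈ T := by simp [hT]
    have e1 := hP.2.2.2
    have e2 := hx'.2.2.2
    have hp3 : p3 = p ∨ p3 = q := by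
      rcases (hT p3').1 g4 with rfl | rfl | rfl | rfl | rfl | rfl
      · exact absurd (sx _ a1.symm) g1
      · exact absurd (sy _ a1.symm) g1
      · exact absurd (sz _ a1.symm) g1
      · rcases (e2 _).1 a1.symm with e | e | e
        · exact absurd (by rw [e, hT]; simp) g1
        · exact .inl e
        · exact .inr e
      · rcases hy2 _ a1.symm with e | e | e
        · exact absurd (by rw [e, hT]; simp) g1
        · exact .inl e
        · exact .inr e
      · exact absurd rfl hne
    rcases hp3 with rfl | rfl
    · rcases (e1 _).1 a2 with e | e | e
      · exact hxz e.symm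
      · exact hq (e ▸ zT)
      · exact hyz e.symm
    · rcases hq2 _ a2 with e | e | e
      · exact hxz e.symm
      · exact hp (e ▸ zT)
      · exact hyz e.symm

theorem caseA1 [Fintype V] (hconn : G.Connected) (hcf : ClawFree G) (hc : IsCubic G)
    (hn : 10 ≤ Fintype.card V) {S T : Finset V} (h : Good G S T)
    (hd : 2 * S.card ≤ T.card) {x y z x' y' z' w : V}
    (hT : ∀ v, v ∈ T ↔ v = x ∨ v = y ∨ v = z ∨ v = x' ∨ v = y' ∨ v = z')
    (hcard : T.card = 6)
    (hx : Nb G x y z x') (hy : Nb G y x z y') (hz : Nb G z x y z')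
    (hxy : x' ≠ y') (hxz : x' ≠ z') (hyz : y' ≠ z')
    (hw : w ∉ T) (hxw : G.Adj x' w) : Win G := by
  have sx : ∀ w, G.Adj x w → w ∈ T := fun w hw => by
    rw [hx.2.2.2] at hw; rw [hT]; tauto
  have sy : ∀ w, G.Adj y w → w ∈ T := fun w hw => by
    rw [hy.2.2.2] at hw; rw [hT]; tauto
  have sz : ∀ w, G.Adj z w → w ∈ T := fun w hw => by
    rw [hz.2.2.2] at hw; rw [hT]; tauto
  have ax : G.Adj x' x := ((hx.2.2.2 x').2 (by simp)).symm
  rcases cls hcf hc h hd (v := x') (u := x) (by simp [hT]) (by simp [hT]) ax sx with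
    g1 | g1 | ⟨p, q, p', q', g1, g2, g3, g4, g5, g6, g7⟩
  · exact g1
  · exact absurd (g1 _ hxw) hw
  · have a1 : G.Adj p p' := (g6.2.2.2 p').2 (by simp)
    rcases (hT p').1 g4 with rfl | rfl | rfl | rfl | rfl | rfl
    · exact absurd (sx _ a1.symm) g1
    · exact absurd (sy _ a1.symm) g1
    · exact absurd (sz _ a1.symm) g1
    · exact absurd rfl g6.2.1
    · exact caseA2 hconn hcf hc hn h hd hT hcard hx hy hz hxy hxz hyz g1 g2 g3 g6 g7
    · exact caseA2 hconn hcf hc hn h hd (x := x) (y := z) (z := y) (x' := x') (y' := p')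
        (z' := y') (fun v => by rw [hT]; tauto) hcard hx.swap hz hy hxz hxy hyz.symm g1 g2 g3 g6 g7

theorem caseA [Fintype V] (hconn : G.Connected) (hcf : ClawFree G) (hc : IsCubic G)
    (hn : 10 ≤ Fintype.card V) {x y z x' y' z' : V}
    (hx : Nb G x y z x') (hy : Nb G y x z y') (hz : Nb G z x y z')
    (hxy : x' ≠ y') (hxz : x' ≠ z') (hyz : y' ≠ z') : Win G := by
  obtain ⟨x1, x2, x3, x4⟩ := id hx
  obtain ⟨y1, y2, y3, y4⟩ := id hy
  obtain ⟨z1, z2, z3, z4⟩ := id hz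
  have ax : G.Adj x x' := (x4 x').2 (by simp)
  have ay : G.Adj y y' := (y4 y').2 (by simp)
  have az : G.Adj z z' := (z4 z').2 (by simp)
  have nx := ax.ne
  have ny := ay.ne
  have nz := az.ne
  have hG : Good G {x, y, z} (insert z' (insert y' (insert x' {x, y, z}))) :=
    (((good_tri (by grind) (by grind)).force (v := x) (by simp) ax (by grind)).force (v := y)
      (by simp) ay (by grind)).force (v := z) (by simp) az (by grind)
  have hcard : (insert z' (insert y' (insert x' ({x, y, z} : Finset V)))).card = 6 := by
    rw [Finset.card_insert_of_notMem (by grind), Finset.card_insert_of_notMem (by grind),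
      Finset.card_insert_of_notMem (by grind), Finset.card_eq_three.2 ⟨x, y, z, by grind⟩]
  have hd : 2 * ({x, y, z} : Finset V).card ≤
      (insert z' (insert y' (insert x' ({x, y, z} : Finset V)))).card := by
    have := Finset.card_le_three (a := x) (b := y) (c := z)
    omega
  generalize hTe : insert z' (insert y' (insert x' ({x, y, z} : Finset V))) = T at *
  generalize ({x, y, z} : Finset V) = S at hG hd
  have hT : ∀ v, v ∈ T ↔ v = x ∨ v = y ∨ v = z ∨ v = x' ∨ v = y' ∨ v = z' := by
    intro v
    rw [← hTe]
    simp only [Finset.mem_insert, Finset.mem_singleton]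
    tauto
  by_cases hcl : ∀ v ∈ T, ∀ w, G.Adj v w → w ∈ T
  · exact (no_closed hconn hn T (x := x) (by simp [hT]) (by omega) hcl).elim
  push Not at hcl
  obtain ⟨v, hv, w, hvw, hw⟩ := hcl
  rcases (hT v).1 hv with rfl | rfl | rfl | rfl | rfl | rfl
  · grind
  · grind
  · grind
  · exact caseA1 hconn hcf hc hn hG hd hT hcard hx hy hz hxy hxz hyz hw hvw
  · exact caseA1 hconn hcf hc hn hG hd (x := y) (y := x) (z := z) (x' := v) (y' := x') (z' := z')
      (fun v => by rw [hT]; tauto) hcard hy hx hz.swap hxy.symm hyz hxz hw hvw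
  · exact caseA1 hconn hcf hc hn hG hd (x := z) (y := x) (z := y) (x' := v) (y' := x') (z' := y')
      (fun v => by rw [hT]; tauto) hcard hz hx.swap hy.swap hxz.symm hyz.symm hxy hw hvw

theorem caseB [Fintype V] (hconn : G.Connected) (hcf : ClawFree G) (hc : IsCubic G)
    (hn : 10 ≤ Fintype.card V) {x y z x' b : V}
    (hx : Nb G x y z x') (hy : Nb G y x z b) (hz : Nb G z x y b) : Win G := by
  obtain ⟨x1, x2, x3, x4⟩ := id hx
  obtain ⟨y1, y2, y3, y4⟩ := id hy
  obtain ⟨z1, z2, z3, z4⟩ := id hz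
  have ax : G.Adj x x' := (x4 x').2 (by simp)
  have ay : G.Adj y b := (y4 b).2 (by simp)
  have az : G.Adj z b := (z4 b).2 (by simp)
  have nx := ax.ne
  have ny := ay.ne
  have nz := az.ne
  obtain ⟨b', hb⟩ := exists_nb2 hc ay.symm az.symm x1
  obtain ⟨b1, b2, b3, b4⟩ := id hb
  have ab : G.Adj b b' := (b4 b').2 (by simp)
  have nb := ab.ne
  by_cases hxb : x' = b
  · subst hxb
    have hb' : b' = x := by
      have := (b4 x).1 ax.symm
      grind
    subst hb'
    refine (no_closed hconn hn {b', y, z, x'} (x := y) (by simp) ?_ ?_).elim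
    · have := Finset.card_le_four (a := b') (b := y) (c := z) (d := x')
      omega
    · intro v hv w hw
      simp only [Finset.mem_insert, Finset.mem_singleton] at hv ⊢
      rcases hv with rfl | rfl | rfl | rfl
      · have := (x4 w).1 hw; tauto
      · have := (y4 w).1 hw; tauto
      · have := (z4 w).1 hw; tauto
      · have := (b4 w).1 hw; tauto
  have hbx : b' ≠ x := by
    rintro rfl
    have := (x4 b).1 ab.symm
    grind
  have hbx' : b' ≠ x' := by
    rintro rfl
    obtain ⟨e, he⟩ := exists_nb2 hc ax.symm ab.symm (by grind)
    have h1 : G.Adj b' e := (he.2.2.2 e).2 (by simp)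
    have := h1.ne
    have := he.1
    have := he.2.1
    have := he.2.2.1
    have ey := (y4 b').1
    have ez := (z4 b').1
    rcases claw hcf he with h2 | h2 | h2
    · have := (x4 b).1 h2
      grind
    · have := (x4 e).1 h2
      have := h1.symm
      grind
    · have := (b4 e).1 h2
      have := h1.symm
      grind
  have hG : Good G {x, y, z} (insert b' (insert b (insert x' {x, y, z}))) :=
    (((good_tri (by grind) (by grind)).force (v := x) (by simp) ax (by grind)).force (v := y)
      (by simp) ay (by grind)).force (v := b) (by simp) ab (by grind)
  have hcard : (insert b' (insert b (insert x' ({x, y, z} : Finset V)))).card = 6 := by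
    rw [Finset.card_insert_of_notMem (by grind), Finset.card_insert_of_notMem (by grind),
      Finset.card_insert_of_notMem (by grind), Finset.card_eq_three.2 ⟨x, y, z, by grind⟩]
  have hd : 2 * ({x, y, z} : Finset V).card ≤
      (insert b' (insert b (insert x' ({x, y, z} : Finset V)))).card := by
    have := Finset.card_le_three (a := x) (b := y) (c := z)
    omega
  generalize hTe : insert b' (insert b (insert x' ({x, y, z} : Finset V))) = T at *
  generalize ({x, y, z} : Finset V) = S at hG hd
  have hT : ∀ v, v ∈ T ↔ v = x ∨ v = y ∨ v = z ∨ v = b ∨ v = x' ∨ v = b' := by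
    intro v
    rw [← hTe]
    simp only [Finset.mem_insert, Finset.mem_singleton]
    tauto
  have sx : ∀ w, G.Adj x w → w ∈ T := fun w hw => by
    rw [x4] at hw; rw [hT]; tauto
  have sy : ∀ w, G.Adj y w → w ∈ T := fun w hw => by
    rw [y4] at hw; rw [hT]; tauto
  have sz : ∀ w, G.Adj z w → w ∈ T := fun w hw => by
    rw [z4] at hw; rw [hT]; tauto
  have sb : ∀ w, G.Adj b w → w ∈ T := fun w hw => by
    rw [b4] at hw; rw [hT]; tauto
  have hxT : x' ∈ T := by simp [hT]
  have hbT : b' ∈ T := by simp [hT]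
  -- a vertex outside `T` with neighbor in `T` is adjacent to `x'` or `b'`
  have out : ∀ p t, p ∉ T → t ∈ T → G.Adj p t → t = x' ∨ t = b' := by
    intro p t hp ht hpt
    rcases (hT t).1 ht with rfl | rfl | rfl | rfl | h | h
    · exact absurd (sx _ hpt.symm) hp
    · exact absurd (sy _ hpt.symm) hp
    · exact absurd (sz _ hpt.symm) hp
    · exact absurd (sb _ hpt.symm) hp
    · exact .inl h
    · exact .inr h
  rcases cls hcf hc hG hd (v := x') (u := x) hxT (by simp [hT]) ax.symm sx with
    g1 | g1 | ⟨p, q, p', q', g1, g2, g3, g4, g5, g6, g7⟩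
  · exact g1
  · rcases cls hcf hc hG hd (v := b') (u := b) hbT (by simp [hT]) ab.symm sb with
      k1 | k1 | ⟨p, q, p', q', k1, k2, k3, k4, k5, k6, k7⟩
    · exact k1
    · refine (no_closed hconn hn T (x := x) (by simp [hT]) (by omega) ?_).elim
      intro v hv w hw
      by_contra hwT
      rcases out w v hwT hv hw.symm with rfl | rfl
      · exact hwT (g1 _ hw)
      · exact hwT (k1 _ hw)
    · exfalso
      have a1 : G.Adj p p' := (k6.2.2.2 p').2 (by simp)
      rcases out p p' k1 k4 a1 with rfl | rfl
      · exact k1 (g1 _ a1.symm)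
      · exact k6.2.1 rfl
  · have a1 : G.Adj p p' := (g6.2.2.2 p').2 (by simp)
    have a2 : G.Adj q q' := (g7.2.2.2 q').2 (by simp)
    have e1 : p' = b' := (out p p' g1 g4 a1).resolve_left g6.2.1.symm
    have e2 : q' = b' := (out q q' g2 g5 a2).resolve_left g7.2.1.symm
    subst e1
    subst e2
    have hb'N : ∀ w, G.Adj q' w → w = b ∨ w = p ∨ w = q := by
      obtain ⟨c, hc'⟩ := exists_nb2 hc a1.symm a2.symm g3.2.2.1
      have e := hc'.2.2.2
      have hbc := (e b).1 ab.symm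
      have hbT : b ∈ T := by simp [hT]
      intro w hw
      have := (e w).1 hw
      grind
    refine (no_closed hconn hn (insert p (insert q T)) (x := p) (by simp) ?_ ?_).elim
    · have := Finset.card_insert_le p (insert q T)
      have := Finset.card_insert_le q T
      omega
    · have f1 := g6.2.2.2
      have f2 := g7.2.2.2
      have f3 := g3.2.2.2
      intro v hv w hw
      simp only [Finset.mem_insert] at hv ⊢
      rcases hv with rfl | rfl | hv
      · grind
      · grind
      · rcases (hT v).1 hv with rfl | rfl | rfl | rfl | rfl | rfl
        · exact .inr (.inr (sx _ hw))
        · exact .inr (.inr (sy _ hw))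
        · exact .inr (.inr (sz _ hw))
        · exact .inr (.inr (sb _ hw))
        · have := (f3 w).1 hw
          grind
        · have := hb'N w hw
          grind

theorem exists_win [Fintype V] (hconn : G.Connected) (hcf : ClawFree G) (hc : IsCubic G)
    (hn : 10 ≤ Fintype.card V) : Win G := by
  have key : ∃ x y z, G.Adj x y ∧ G.Adj x z ∧ G.Adj y z := by
    obtain ⟨v⟩ := hconn.nonempty
    obtain ⟨a, b, c, hN⟩ := exists_nb hc v
    have h := hN.2.2.2
    rcases claw hcf hN with h1 | h1 | h1
    · exact ⟨v, a, b, (h _).2 (by simp), (h _).2 (by simp), h1⟩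
    · exact ⟨v, a, c, (h _).2 (by simp), (h _).2 (by simp), h1⟩
    · exact ⟨v, b, c, (h _).2 (by simp), (h _).2 (by simp), h1⟩
  obtain ⟨x, y, z, hxy, hxz, hyz⟩ := key
  obtain ⟨x', hx⟩ := exists_nb2 hc hxy hxz hyz.ne
  obtain ⟨y', hy⟩ := exists_nb2 hc hxy.symm hyz hxz.ne
  obtain ⟨z', hz⟩ := exists_nb2 hc hxz.symm hyz.symm hxy.ne
  by_cases h1 : y' = z'
  · subst h1
    exact caseB hconn hcf hc hn hx hy hz
  by_cases h2 : x' = z'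
  · subst h2
    exact caseB hconn hcf hc hn hy hx hz.swap
  by_cases h3 : x' = y'
  · subst h3
    exact caseB hconn hcf hc hn hz hx.swap hy.swap
  exact caseA hconn hcf hc hn hx hy hz h3 h2 h1

end aux

/-- If `G` is a connected, claw-free, cubic graph of order `n ≥ 10`, then
`F(G) < n/2`. -/
theorem forcingNumber_lt_half {V : Type*} [Fintype V]
    (G : SimpleGraph V) (hconn : G.Connected) (hcf : ClawFree G) (hcubic : IsCubic G)
    (hn : 10 ≤ Fintype.card V) :
    2 * forcingNumber G < Fintype.card V := by
  classical
  obtain ⟨S, T, hG, hlt⟩ := exists_win hconn hcf hcubic hn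
  obtain ⟨S', hG', hlt'⟩ := finish hconn hcubic (Fintype.card V) S T hG hlt (by omega)
  have hle : forcingNumber G ≤ S'.card := by
    refine Nat.sInf_le ⟨(S' : Set V), fun C hS hC v => ?_, Set.ncard_coe_finset S'⟩
    exact hG'.1 C (fun v hv => hS (by simpa using hv)) hC v (Finset.mem_univ v)
  omega
end
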